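/- (Theorem 2) For every b ≥ 1, if FC_{b+1} = FC_b, then the sets of keys distinguishable at depths b and b+1 coincide: K̄_b = K̄_{b+1}, i.e. a key k admits an input i : Fin b → Inp with f_b(i) ≠ f'_b(i, k) if and only if it admits an input i' : Fin (b+1) → Inp with f_{b+1}(i') ≠ f'_{b+1}(i', k). -/

import Mathlib

/-- A Mealy machine with input alphabet `Inp` and output alphabet `Out`. -/
structure Mealy (Inp Out : Type) where
  S : Type
  δ : S → Inp → S
  ω : S → Inp → Out

namespace Mealy

variable {Inp Out : Type}

/-- The state reached from `s` after consuming an input sequence of length `b`. -/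
def states (M : Mealy Inp Out) (s : M.S) : (b : ℕ) → (Fin b → Inp) → M.S
  | 0, _ => s
  | b + 1, i => M.δ (M.states s b (i ∘ Fin.castSucc)) (i (Fin.last b))

/-- The `b`-unrolled output from state `s`: `out s b i t = ω s_t (i t)`,
where `s_0 = s` and `s_{t+1} = δ s_t (i t)`. -/
def out (M : Mealy Inp Out) (s : M.S) (b : ℕ) (i : Fin b → Inp) (t : Fin b) : Out :=
  M.ω (M.states s t.1 (fun j => i (Fin.castLE t.isLt.le j))) (i t)

end Mealy

/-- Input alphabet: `n`-bit vectors. -/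
abbrev Inp (n : ℕ) : Type := Fin n → Bool

/-- Output alphabet: `m`-bit vectors. -/
abbrev Out (m : ℕ) : Type := Fin m → Bool

/-- The prefix of a `(b+1)`-length sequence. -/
def pre {α : Type} {b : ℕ} (i : Fin (b + 1) → α) : Fin b → α := i ∘ Fin.castSucc

/-- `f_b`: the `b`-unrolled output of the oracle circuit from its initial state `s0`. -/
def fOut {n m : ℕ} (Mo : Mealy (Inp n) (Out m)) (s0 : Mo.S) (b : ℕ)
    (i : Fin b → Inp n) : Fin b → Out m :=
  Mo.out s0 b i

/-- `f'_b`: the `b`-unrolled output of the encrypted circuit after applying the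
key sequence `k` from its initial state `s0'`. -/
def fOut' {n m : ℕ} (tk : ℕ) (Me : Mealy (Inp n) (Out m)) (s0' : Me.S) (b : ℕ)
    (i : Fin b → Inp n) (k : Fin tk → Inp n) : Fin b → Out m :=
  Me.out (Me.states s0' tk k) b i

/-- The number of error pairs `(i, k)` at unrolling depth `b`. -/
def errCount {n m : ℕ} (tk : ℕ) (Mo Me : Mealy (Inp n) (Out m)) (s0 : Mo.S) (s0' : Me.S)
    (b : ℕ) : ℕ :=
  Fintype.card {p : (Fin b → Inp n) × (Fin tk → Inp n) //
    fOut Mo s0 b p.1 ≠ fOut' tk Me s0' b p.1 p.2}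

/-- The `b`-depth functional corruptibility. -/
def FC (n m tk : ℕ) (Mo Me : Mealy (Inp n) (Out m)) (s0 : Mo.S) (s0' : Me.S) (b : ℕ) : ℚ :=
  (errCount tk Mo Me s0 s0' b : ℚ) / 2 ^ ((b + tk) * n)

/-- `K̄_b`: the set of keys distinguishable at depth `b`. -/
def Kbar {n m : ℕ} (tk : ℕ) (Mo Me : Mealy (Inp n) (Out m)) (s0 : Mo.S) (s0' : Me.S)
    (b : ℕ) : Set (Fin tk → Inp n) :=
  {k | ∃ i : Fin b → Inp n, fOut Mo s0 b i ≠ fOut' tk Me s0' b i k}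

namespace Mealy

theorem out_castSucc {Inp Out : Type} (M : Mealy Inp Out) (s : M.S) (b : ℕ)
    (i : Fin (b + 1) → Inp) (t : Fin b) :
    M.out s (b + 1) i t.castSucc = M.out s b (pre i) t := rfl

/-- Outputs that differ on a prefix differ on the whole sequence. -/
theorem out_ne_of_out_pre_ne {Inp Out : Type} {M N : Mealy Inp Out} {s : M.S} {s' : N.S} {b : ℕ}
    {i : Fin (b + 1) → Inp} (h : M.out s b (pre i) ≠ N.out s' b (pre i)) :
    M.out s (b + 1) i ≠ N.out s' (b + 1) i := fun he =>
  h <| funext fun t => by rw [← out_castSucc, ← out_castSucc, he]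

end Mealy

theorem pre_snoc {α : Type} {b : ℕ} (i : Fin b → α) (x : α) :
    pre (Fin.snoc i x : Fin (b + 1) → α) = i := by
  funext t
  simp [pre]

/-- An error pair at depth `b`, extended by one arbitrary further input. -/
def extendError {n m : ℕ} (tk : ℕ) (Mo Me : Mealy (Inp n) (Out m)) (s0 : Mo.S) (s0' : Me.S)
    (b : ℕ)
    (q : {p : (Fin b → Inp n) × (Fin tk → Inp n) //
      fOut Mo s0 b p.1 ≠ fOut' tk Me s0' b p.1 p.2} × Inp n) :
    {p : (Fin (b + 1) → Inp n) × (Fin tk → Inp n) //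
      fOut Mo s0 (b + 1) p.1 ≠ fOut' tk Me s0' (b + 1) p.1 p.2} :=
  ⟨(Fin.snoc q.1.1.1 q.2, q.1.1.2), Mealy.out_ne_of_out_pre_ne (by
    rw [pre_snoc]
    exact q.1.2)⟩

theorem extendError_injective {n m : ℕ} (tk : ℕ) (Mo Me : Mealy (Inp n) (Out m)) (s0 : Mo.S)
    (s0' : Me.S) (b : ℕ) : Function.Injective (extendError tk Mo Me s0 s0' b) := by
  rintro ⟨⟨⟨i, k⟩, hi⟩, x⟩ ⟨⟨⟨j, l⟩, hj⟩, y⟩ h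
  have h1 : (Fin.snoc i x : Fin (b + 1) → Inp n) = Fin.snoc j y := congrArg (fun p => p.1.1) h
  obtain rfl : k = l := congrArg (fun p => p.1.2) h
  obtain ⟨rfl, rfl⟩ := Fin.snoc_inj.mp h1
  rfl

theorem errCount_succ_of_FC_succ_eq {n m tk : ℕ} {Mo Me : Mealy (Inp n) (Out m)} {s0 : Mo.S}
    {s0' : Me.S} {b : ℕ} (h : FC n m tk Mo Me s0 s0' (b + 1) = FC n m tk Mo Me s0 s0' b) :
    errCount tk Mo Me s0 s0' (b + 1) = errCount tk Mo Me s0 s0' b * 2 ^ n := by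
  have hexp : (b + 1 + tk) * n = (b + tk) * n + n := by ring
  rw [FC, FC, hexp, pow_add, div_eq_div_iff (by positivity) (by positivity),
    mul_comm, mul_left_comm] at h
  exact_mod_cast mul_left_cancel₀ (by positivity) h

/-- Theorem 2: if `FC_{b+1} = FC_b` then `K̄_b = K̄_{b+1}`. -/
theorem stmt_7 (n m tk : ℕ) (hn : 1 ≤ n) (hm : 1 ≤ m) (htk : 1 ≤ tk)
    (Mo Me : Mealy (Inp n) (Out m)) (s0 : Mo.S) (s0' : Me.S)
    (b : ℕ) (hb : 1 ≤ b)
    (h : FC n m tk Mo Me s0 s0' (b + 1) = FC n m tk Mo Me s0 s0' b) :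
    Kbar tk Mo Me s0 s0' b = Kbar tk Mo Me s0 s0' (b + 1) := by
  have hbij : Function.Bijective (extendError tk Mo Me s0 s0' b) := by
    rw [Fintype.bijective_iff_injective_and_card]
    refine ⟨extendError_injective tk Mo Me s0 s0' b, ?_⟩
    have hc := errCount_succ_of_FC_succ_eq h
    rw [errCount, errCount] at hc
    rw [Fintype.card_prod, hc]
    simp
  ext k
  constructor
  · rintro ⟨i, hi⟩
    exact ⟨_, (extendError tk Mo Me s0 s0' b (⟨(i, k), hi⟩, fun _ => false)).2⟩
  · rintro ⟨i, hi⟩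
    obtain ⟨⟨⟨⟨j, l⟩, hj⟩, x⟩, hq⟩ := hbij.2 ⟨(i, k), hi⟩
    obtain rfl : l = k := congrArg (fun p => p.1.2) hq
    exact ⟨j, hj⟩
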